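/- Let Γ be a layered graph with unique minimal vertex, and let R_gr be the ideal of T(V^+) generated by {v(π_1,k) − v(π_2,k) : t(π_1) = t(π_2), 2 ≤ k ≤ l(π_1)}. Then the associated graded algebra gr A(Γ) of A(Γ) = T(E)/R is isomorphic to T(V^+)/R_gr. -/

import Mathlib

noncomputable section

/-- A layered directed graph: vertices come with a rank (layer), and each
edge goes from a vertex of rank `j+1` to a vertex of rank `j`. -/
structure LayeredGraph where
  V : Type
  E : Type
  rank : V → ℕ
  tail : E → V
  head : E → V
  rank_tail : ∀ e, rank (tail e) = rank (head e) + 1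

namespace LayeredGraph

variable (G : LayeredGraph)

/-- `V₀ = {*}`: there is a unique vertex of rank `0`. -/
def HasUniqueMin : Prop := ∃ s : G.V, G.rank s = 0 ∧ ∀ v, G.rank v = 0 → v = s

/-- Every vertex of `V⁺` has at least one outgoing edge. -/
def EdgeFull : Prop := ∀ v, G.rank v ≠ 0 → ∃ e, G.tail e = v

/-- `u` covers `w`: there is an edge from `u` to `w`. -/
def adj (u w : G.V) : Prop := ∃ e, G.tail e = u ∧ G.head e = w

/-- `v ≥ u` with a prescribed rank drop `j` (this is `u ∈ S_j(v)`;
for `j = 0` it forces `u = v`). -/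
def SRel (v u : G.V) (j : ℕ) : Prop :=
  Relation.ReflTransGen G.adj v u ∧ G.rank u + j = G.rank v

/-- A uniform layered graph: for each vertex `v` of rank `≥ 2`, all elements of
`S₁(v)` are equivalent under the equivalence relation generated by
`u ∼ w ↔ S₁(u) ∩ S₁(w) ≠ ∅`. -/
def Uniform : Prop := ∀ v u w, 2 ≤ G.rank v → G.adj v u → G.adj v w →
  Relation.EqvGen (fun a b => G.adj v a ∧ G.adj v b ∧ ∃ x, G.adj a x ∧ G.adj b x) u w

/-- A (nonempty) directed path: a nonempty list of composable edges. -/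
def IsPathList (l : List G.E) : Prop :=
  l ≠ [] ∧ l.Chain' (fun e f => G.head e = G.tail f)

/-- The tail (initial vertex) of a path, as an `Option`. -/
def firstV (l : List G.E) : Option G.V := l.head?.map G.tail

/-- The head (final vertex) of a path, as an `Option`. -/
def lastV (l : List G.E) : Option G.V := l.getLast?.map G.head

/-- The list `v₀, v₁, …, v_m` of vertices visited by a path. -/
def pathVerts (l : List G.E) : List G.V :=
  match l with
  | [] => []
  | e :: _ => G.tail e :: l.map G.head

/-- The type `V⁺` of vertices of positive rank. -/
def Vp := {v : G.V // G.rank v ≠ 0}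

variable (F : Type) [Field F]

/-- The coefficient `e(π,k)` of `t^k` in `P_π(t) = (1 - te₁)⋯(1 - te_m)`,
an element of the tensor algebra `T(E)` (modelled as the free algebra on `E`). -/
def ecoef (π : List G.E) (k : ℕ) : FreeAlgebra F G.E :=
  ((-1 : F) ^ k) • ((π.sublistsLen k).map fun l => (l.map (FreeAlgebra.ι F)).prod).sum

/-- The two-sided ideal generated by a set, as a submodule. -/
def twoSidedSpan {A : Type} [Ring A] [Algebra F A] (S : Set A) : Submodule F A :=
  Submodule.span F {x | ∃ a s b, s ∈ S ∧ x = a * s * b}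

/-- The defining ideal `R` of `A(Γ)`, generated by the differences
`e(π₁,k) - e(π₂,k)` over pairs of paths with the same tail and the same head. -/
def Rideal : Submodule F (FreeAlgebra F G.E) :=
  twoSidedSpan F {x | ∃ π₁ π₂ k, G.IsPathList π₁ ∧ G.IsPathList π₂ ∧
    G.firstV π₁ = G.firstV π₂ ∧ G.lastV π₁ = G.lastV π₂ ∧
    1 ≤ k ∧ k ≤ π₁.length ∧ x = G.ecoef F π₁ k - G.ecoef F π₂ k}

/-- A vertex viewed in `T(V⁺)` (the free algebra on `V⁺`), with `*` sent to `0`. -/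
def vert (v : G.V) : FreeAlgebra F G.Vp :=
  if h : G.rank v = 0 then 0 else FreeAlgebra.ι F (⟨v, h⟩ : G.Vp)

/-- The algebra homomorphism `θ : T(E) → T(V⁺)`, induced by `e ↦ t(e) - h(e)`. -/
def theta : FreeAlgebra F G.E →ₐ[F] FreeAlgebra F G.Vp :=
  FreeAlgebra.lift F fun e => G.vert F (G.tail e) - G.vert F (G.head e)

/-- The filtration `T(E)_i` of `T(E)`, where an edge `e` has degree `|t(e)|`. -/
def filtE (i : ℕ) : Submodule F (FreeAlgebra F G.E) :=
  Submodule.span F {x | ∃ l : List G.E, (l.map fun e => G.rank (G.tail e)).sum ≤ i ∧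
    x = (l.map (FreeAlgebra.ι F)).prod}

/-- The homogeneous component `T(V⁺)_[i]` of `T(V⁺)`,
where a vertex has degree equal to its rank. -/
def homogV (i : ℕ) : Submodule F (FreeAlgebra F G.Vp) :=
  Submodule.span F {x | ∃ l : List G.Vp, (l.map fun p => G.rank p.1).sum = i ∧
    x = (l.map (FreeAlgebra.ι F)).prod}

/-- The filtration `T(V⁺)_i` of `T(V⁺)` induced by the vertex grading. -/
def filtV (i : ℕ) : Submodule F (FreeAlgebra F G.Vp) :=
  Submodule.span F {x | ∃ l : List G.Vp, (l.map fun p => G.rank p.1).sum ≤ i ∧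
    x = (l.map (FreeAlgebra.ι F)).prod}

/-- The associated graded ideal `gr I` of an ideal `I ⊆ T(V⁺)`: its degree-`k`
component is `T(V⁺)_[k] ∩ (T(V⁺)_{k-1} + I)`. -/
def grIdeal (I : Submodule F (FreeAlgebra F G.Vp)) : Submodule F (FreeAlgebra F G.Vp) :=
  ⨆ k, G.homogV F k ⊓ ((⨆ j, ⨆ _ : j < k, G.homogV F j) ⊔ I)

/-- The monomial `v(π,k) = v₀v₁⋯v_{k-1} ∈ T(V⁺)` attached to a path `π`. -/
def vmon (π : List G.E) (k : ℕ) : FreeAlgebra F G.Vp :=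
  (((G.pathVerts π).take k).map (G.vert F)).prod

/-- The ideal `R_gr ⊆ T(V⁺)`, generated by the differences `v(π₁,k) - v(π₂,k)`
over pairs of paths with common tail. -/
def Rgr : Submodule F (FreeAlgebra F G.Vp) :=
  twoSidedSpan F {x | ∃ π₁ π₂ k, G.IsPathList π₁ ∧ G.IsPathList π₂ ∧
    G.firstV π₁ = G.firstV π₂ ∧ 2 ≤ k ∧ k ≤ π₁.length ∧ k ≤ π₂.length ∧
    x = G.vmon F π₁ k - G.vmon F π₂ k}

/-- The degree-one subspace `V = F·V⁺ ⊆ T(V⁺)`. -/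
def Wone : Submodule F (FreeAlgebra F G.Vp) :=
  Submodule.span F (Set.range (FreeAlgebra.ι F))

/-- The quadratic relation space `R` of `gr A(Γ)`,
spanned by the elements `v(u - w)` with `u, w ∈ S₁(v)`. -/
def Rquad : Submodule F (FreeAlgebra F G.Vp) :=
  Submodule.span F {x | ∃ v u w, G.adj v u ∧ G.adj v w ∧
    x = G.vert F v * (G.vert F u - G.vert F w)}

/-- `S_j(v) = span{u : v > u, |u| = |v| - j}` (with `S₀(v) = span{v}`). -/
def Sspan (j : ℕ) (v : G.V) : Submodule F (FreeAlgebra F G.Vp) :=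
  Submodule.span F {x | ∃ u, G.SRel v u j ∧ x = G.vert F u}

/-- `P_j(v) = span{u - w : v > u, v > w, |u| = |w| = |v| - j}`. -/
def Pspan (j : ℕ) (v : G.V) : Submodule F (FreeAlgebra F G.Vp) :=
  Submodule.span F {x | ∃ u w, G.SRel v u j ∧ G.SRel v w j ∧
    x = G.vert F u - G.vert F w}

end LayeredGraph

/-- The elements of the sublattice generated by a family of subspaces. -/
inductive latGen {α : Type*} [Lattice α] (S : Set α) : α → Prop
  | base {x} : x ∈ S → latGen S x
  | inf {x y} : latGen S x → latGen S y → latGen S (x ⊓ y)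
  | sup {x y} : latGen S x → latGen S y → latGen S (x ⊔ y)

/-- A family of elements of a lattice is distributive if the sublattice
it generates is distributive. -/
def IsDistribFamily {α : Type*} [Lattice α] (S : Set α) : Prop :=
  ∀ x y z, latGen S x → latGen S y → latGen S z → x ⊓ (y ⊔ z) = (x ⊓ y) ⊔ (x ⊓ z)

/-- Backelin's criterion: a quadratic algebra `T(V)/(R)` (given by the degree-one
subspace `V` and the relation space `R ⊆ V⊗V` inside the tensor algebra) is Koszul
iff for each `k` the collection of subspaces `V^i R V^(k-i)` generates a
distributive lattice. -/
def IsKoszulQuad (F : Type) [Field F] {A : Type} [Ring A] [Algebra F A]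
    (W R : Submodule F A) : Prop :=
  ∀ k : ℕ, IsDistribFamily {X | ∃ i ≤ k, X = W ^ i * R * W ^ (k - i)}

end

noncomputable section

/-- A linear endomorphism of `ι →₀ F` that is unitriangular with respect to a weight `ω : ι → ℕ`
is injective, and every weight-bounded vector has a preimage with the same bound. -/
theorem Finsupp.unitriangular_bijective {ι F : Type*} [Field F] (ω : ι → ℕ)
    (T : (ι →₀ F) →ₗ[F] (ι →₀ F))
    (hT : ∀ p, T (Finsupp.single p 1) - Finsupp.single p 1 ∈
      Finsupp.supported F F {q | ω q < ω p}) :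
    Function.Injective T ∧ ∀ n, ∀ x ∈ Finsupp.supported F F {q | ω q < n},
      ∃ y ∈ Finsupp.supported F F {q | ω q < n}, T y = x := by
  have mono : ∀ {m n : ℕ}, m ≤ n → Finsupp.supported F F {q | ω q < m} ≤
      Finsupp.supported F F {q | ω q < n} := fun h =>
    Finsupp.supported_mono fun q (hq : _ < _) => lt_of_lt_of_le hq h
  have key : ∀ n, ∀ x ∈ Finsupp.supported F F {q | ω q < n + 1},
      T x - x ∈ Finsupp.supported F F {q | ω q < n} := by
    intro n x hx
    rw [Finsupp.supported_eq_span_single] at hx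
    induction hx using Submodule.span_induction with
    | mem x h =>
      obtain ⟨p, hp, rfl⟩ := h
      exact mono (Nat.lt_succ_iff.mp hp) (hT p)
    | zero => simp
    | add x y _ _ hx hy =>
      rw [map_add, add_sub_add_comm]
      exact Submodule.add_mem _ hx hy
    | smul c x _ hx =>
      rw [map_smul, ← smul_sub]
      exact Submodule.smul_mem _ _ hx
  have exhaust : ∀ x : ι →₀ F, ∃ n, x ∈ Finsupp.supported F F {q | ω q < n} := by
    intro x
    refine ⟨x.support.sup ω + 1, ?_⟩
    rw [Finsupp.mem_supported]
    intro q hq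
    exact Nat.lt_succ_of_le (Finset.le_sup (f := ω) hq)
  have zero : ∀ x ∈ Finsupp.supported F F {q | ω q < 0}, x = 0 := by
    intro x hx
    simpa using hx
  constructor
  · rw [injective_iff_map_eq_zero]
    intro x hx
    obtain ⟨n, hn⟩ := exhaust x
    induction n with
    | zero => exact zero x hn
    | succ n ih =>
      apply ih
      simpa [hx] using key n x hn
  · intro n
    induction n with
    | zero => exact fun x hx => ⟨0, by simp, by simp [zero x hx]⟩
    | succ n ih =>
      intro x hx
      obtain ⟨y, hy, hxy⟩ := ih _ (key n x hx)
      exact ⟨x - y, Submodule.sub_mem _ hx (mono n.le_succ hy), by rw [map_sub, hxy]; abel⟩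

/-- The coefficients of `∏ (X + aᵢ)` over a noncommutative ring are the elementary symmetric
expressions in the `aᵢ`, with the factors kept in order. -/
theorem Polynomial.coeff_list_prod_X_add_C {A ι : Type*} [Ring A] (f : ι → A) (π : List ι) :
    (∀ j, π.length < j → ((π.map fun e => (X + C (f e) : Polynomial A)).prod).coeff j = 0) ∧
    ∀ j k, j + k = π.length → ((π.map fun e => (X + C (f e) : Polynomial A)).prod).coeff j =
      ((π.sublistsLen k).map fun l => (l.map f).prod).sum := by
  induction π with
  | nil =>
    constructor
    · intro j hj
      simp only [List.length_nil] at hj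
      simp [Polynomial.coeff_one, hj.ne']
    · intro j k h
      simp only [List.length_nil, Nat.add_eq_zero_iff] at h
      simp [h.1, h.2]
  | cons e π ih =>
    obtain ⟨ih0, ih1⟩ := ih
    simp only [List.map_cons, List.prod_cons, List.length_cons]
    constructor
    · rintro (_ | j) hj
      · omega
      · rw [add_mul, Polynomial.coeff_add, Polynomial.coeff_X_mul, Polynomial.coeff_C_mul,
          ih0 _ (by omega), ih0 _ (by omega)]
        simp
    · rintro (_ | j) (_ | k) h
      · omega
      · rw [add_mul, Polynomial.coeff_add, Polynomial.coeff_X_mul_zero, Polynomial.coeff_C_mul,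
          ih1 0 k (by omega), List.sublistsLen_succ_cons,
          List.sublistsLen_of_length_lt (show π.length < k + 1 by omega)]
        simp [List.sum_map_mul_left, Function.comp_def]
      · rw [add_mul, Polynomial.coeff_add, Polynomial.coeff_X_mul, Polynomial.coeff_C_mul,
          ih1 j 0 (by omega), ih0 _ (by omega)]
        simp
      · rw [add_mul, Polynomial.coeff_add, Polynomial.coeff_X_mul, Polynomial.coeff_C_mul,
          ih1 j (k + 1) (by omega), ih1 (j + 1) k (by omega), List.sublistsLen_succ_cons]
        simp [List.sum_map_mul_left, Function.comp_def]

namespace LayeredGraph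

variable (G : LayeredGraph)

/-- Words in the symbols `(b, m)`, which stand for the monomials `v(π, m)` with `π` starting
at `b`. The last letter of the word is the head of the list. -/
abbrev Word := List (G.V × ℕ)

/-- `G.Comp W w`: the last letter `(b, m)` of `W` absorbs `w`, that is `w` lies `m` layers
below `b`, and `(b, m)` is not itself absorbed by the rest of the word. -/
def Comp : G.Word → G.V → Prop
  | [], _ => False
  | (b, m) :: U, w => ¬ Comp U b ∧ m ≠ 0 ∧ G.SRel b w m

/-- The word `U` followed by the letter `(b, m)`, where `(b, 0)` is the empty word. -/
def ext (U : G.Word) (b : G.V) : ℕ → G.Word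
  | 0 => U
  | m + 1 => (b, m + 1) :: U

open Classical in
/-- The pair `(U, b)` with `W = ext U b (|b| - |w|)` through which `w` is appended to `W`. -/
def base (W : G.Word) (w : G.V) : G.Word × G.V :=
  match W with
  | [] => ([], w)
  | (b, m) :: U => if G.Comp ((b, m) :: U) w then (U, b) else ((b, m) :: U, w)

/-- The word obtained by appending the vertex `w` to `W`. -/
def app (W : G.Word) (w : G.V) : G.Word :=
  G.ext (G.base W w).1 (G.base W w).2 (G.rank (G.base W w).2 - G.rank w + 1)

/-- The degree of a word. -/
def wdeg (W : G.Word) : ℕ :=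
  (W.map fun p => ∑ i ∈ Finset.range p.2, (G.rank p.1 - i)).sum

variable {G}

theorem wdeg_ext (U : G.Word) (b : G.V) (m : ℕ) :
    G.wdeg (G.ext U b m) = G.wdeg U + ∑ i ∈ Finset.range m, (G.rank b - i) := by
  cases m <;> simp [ext, wdeg, add_comm]

theorem wdeg_ext_succ (U : G.Word) (b : G.V) (m : ℕ) :
    G.wdeg (G.ext U b (m + 1)) = G.wdeg (G.ext U b m) + (G.rank b - m) := by
  rw [wdeg_ext, wdeg_ext, Finset.sum_range_succ, add_assoc]

theorem rank_le_of_reflTransGen {b w : G.V} (h : Relation.ReflTransGen G.adj b w) :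
    G.rank w ≤ G.rank b ∧ (G.rank w = G.rank b → w = b) := by
  induction h with
  | refl => simp
  | tail _ hadj ih =>
    obtain ⟨e, rfl, rfl⟩ := hadj
    have := G.rank_tail e
    exact ⟨by omega, fun h => by omega⟩

theorem base_of_comp {b : G.V} {m : ℕ} {U : G.Word} {w : G.V} (h : G.Comp ((b, m) :: U) w) :
    G.base ((b, m) :: U) w = (U, b) := by
  simp [base, h]

theorem base_of_not_comp {W : G.Word} {w : G.V} (h : ¬ G.Comp W w) : G.base W w = (W, w) := by
  rcases W with _ | ⟨⟨b, m⟩, U⟩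
  · rfl
  · simp [base, h]

theorem base_spec (W : G.Word) (w : G.V) :
    ¬ G.Comp (G.base W w).1 (G.base W w).2 ∧
    Relation.ReflTransGen G.adj (G.base W w).2 w ∧
    G.ext (G.base W w).1 (G.base W w).2 (G.rank (G.base W w).2 - G.rank w) = W := by
  by_cases h : G.Comp W w
  · rcases W with _ | ⟨⟨b, m⟩, U⟩
    · exact h.elim
    · rw [base_of_comp h]
      obtain ⟨h1, h2, h3, h4⟩ := h
      refine ⟨h1, h3, ?_⟩
      obtain ⟨m, rfl⟩ := Nat.exists_eq_succ_of_ne_zero h2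
      simp [← h4, ext]
  · rw [base_of_not_comp h]
    exact ⟨h, .refl, by simp [ext]⟩

theorem base_ext {U : G.Word} {b w : G.V} (hU : ¬ G.Comp U b)
    (h : Relation.ReflTransGen G.adj b w) :
    G.base (G.ext U b (G.rank b - G.rank w)) w = (U, b) := by
  obtain ⟨h1, h2⟩ := rank_le_of_reflTransGen h
  rcases hm : G.rank b - G.rank w with _ | m
  · obtain rfl := h2 (by omega)
    exact base_of_not_comp hU
  · exact base_of_comp ⟨hU, by omega, h, by omega⟩

theorem wdeg_app (W : G.Word) (w : G.V) : G.wdeg (G.app W w) = G.wdeg W + G.rank w := by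
  obtain ⟨-, h2, h3⟩ := base_spec W w
  have := (rank_le_of_reflTransGen h2).1
  rw [app, wdeg_ext_succ, h3]
  omega

variable (G) (F : Type) [Field F]

/-- The polynomial `∑ U(b,i) s^(|b|-i+j)` in `s` with coefficients formal combinations of words. -/
def gen (U : G.Word) (b : G.V) (j : ℕ) : (G.Word × ℕ) →₀ F :=
  ∑ i ∈ Finset.range (G.rank b + 1), Finsupp.single (G.ext U b i, G.rank b - i + j) 1

/-- The `F[s]`-submodule attached to the vertex `w`. -/
def ker (w : G.V) : Submodule F ((G.Word × ℕ) →₀ F) :=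
  Submodule.span F {x | ∃ U b j, Relation.ReflTransGen G.adj b w ∧ ¬ G.Comp U b ∧
    x = G.gen F U b j}

/-- A weight on monomials `W s^n` adapted to division by the relations of the vertex `w`. -/
def weight (w : G.V) (p : G.Word × ℕ) : ℕ := 3 * G.wdeg p.1 + (3 * G.rank w + 1) * p.2

/-- The endomorphism replacing `W s^n`, for `n ≥ |w|`, by the relation with this leading term. -/
def tri (w : G.V) : ((G.Word × ℕ) →₀ F) →ₗ[F] ((G.Word × ℕ) →₀ F) :=
  Finsupp.linearCombination F fun p =>
    if p.2 < G.rank w then Finsupp.single p 1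
    else G.gen F (G.base p.1 w).1 (G.base p.1 w).2 (p.2 - G.rank w)

variable {G}

theorem weight_gen_lt {b w : G.V} (U : G.Word) (j : ℕ) (h : G.rank w ≤ G.rank b) (i : ℕ)
    (hi : i ≤ G.rank b) (h1 : i ≠ G.rank b - G.rank w) (h2 : i ≠ G.rank b - G.rank w + 1) :
    G.weight w (G.ext U b i, G.rank b - i + j) + 2 ≤
      G.weight w (G.ext U b (G.rank b - G.rank w), G.rank w + j) := by
  have step : ∀ i, i < G.rank b → G.weight w (G.ext U b (i + 1), G.rank b - (i + 1) + j) +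
      (3 * G.rank w + 1) = G.weight w (G.ext U b i, G.rank b - i + j) + 3 * (G.rank b - i) := by
    intro i hi
    obtain ⟨c, hc⟩ : ∃ c, G.rank b - i = c + 1 := ⟨G.rank b - i - 1, by omega⟩
    have hc' : G.rank b - (i + 1) = c := by omega
    simp only [weight, wdeg_ext_succ, hc, hc']
    ring
  obtain ⟨m, hm⟩ : ∃ m, G.rank b = G.rank w + m := ⟨G.rank b - G.rank w, by omega⟩
  have hm' : G.rank b - G.rank w = m := by omega
  rw [hm'] at h1 h2 ⊢
  have hw : G.rank w + j = G.rank b - m + j := by omega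
  rw [hw]
  rcases lt_or_gt_of_ne h1 with hlt | hgt
  · obtain ⟨k, rfl⟩ : ∃ k, m = i + 1 + k := ⟨m - i - 1, by omega⟩
    clear h1 h2 hm' hw
    have : ∀ l, i + 1 + l ≤ i + 1 + k → G.weight w (G.ext U b i, G.rank b - i + j) + 2 ≤
        G.weight w (G.ext U b (i + 1 + l), G.rank b - (i + 1 + l) + j) := by
      intro l
      induction l with
      | zero =>
        intro _
        have := step i (by omega)
        simp only [add_zero]
        omega
      | succ l ih =>
        intro hl
        have h1 := ih (by omega)
        have h2 := step (i + 1 + l) (by omega)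
        rw [← add_assoc]
        omega
    exact this k le_rfl
  · obtain ⟨k, rfl⟩ : ∃ k, i = m + 2 + k := ⟨i - m - 2, by omega⟩
    clear h1 h2 hgt
    have : ∀ l, m + 2 + l ≤ m + 2 + k →
        G.weight w (G.ext U b (m + 2 + l), G.rank b - (m + 2 + l) + j) + 2 ≤
        G.weight w (G.ext U b m, G.rank b - m + j) := by
      intro l
      induction l with
      | zero =>
        intro _
        have h1 := step m (by omega)
        have h2 := step (m + 1) (by omega)
        simp only [add_zero]
        simp only [add_assoc, Nat.reduceAdd] at h2 ⊢
        omega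
      | succ l ih =>
        intro hl
        have h1 := ih (by omega)
        have h2 := step (m + 2 + l) (by omega)
        rw [← add_assoc]
        omega
    exact this k le_rfl

theorem weight_gen_succ {b w : G.V} (U : G.Word) (j : ℕ) (h : G.rank w ≤ G.rank b)
    (h0 : 0 < G.rank w) :
    G.weight w (G.ext U b (G.rank b - G.rank w + 1), G.rank w - 1 + j) + 1 =
      G.weight w (G.ext U b (G.rank b - G.rank w), G.rank w + j) := by
  obtain ⟨c, hc⟩ : ∃ c, G.rank w = c + 1 := ⟨G.rank w - 1, by omega⟩
  have : G.rank b - (G.rank b - G.rank w) = G.rank w := by omega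
  simp only [weight, wdeg_ext_succ, this]
  rw [hc, Nat.add_sub_cancel]
  ring

variable {F}

/-- The leading terms of `gen U b j` relative to a vertex `w ≤ b`. -/
theorem gen_sub_leading_mem {b w : G.V} (U : G.Word) (j : ℕ) (h : G.rank w ≤ G.rank b) :
    G.gen F U b j - Finsupp.single (G.ext U b (G.rank b - G.rank w), G.rank w + j) 1 -
      (if 0 < G.rank w then
        Finsupp.single (G.ext U b (G.rank b - G.rank w + 1), G.rank w - 1 + j) 1 else 0) ∈
    Finsupp.supported F F {q | G.weight w q + 2 ≤
      G.weight w (G.ext U b (G.rank b - G.rank w), G.rank w + j)} := by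
  set m := G.rank b - G.rank w with hm
  have hterm : ∀ i ≤ G.rank b, i ≠ m → i ≠ m + 1 →
      Finsupp.single (G.ext U b i, G.rank b - i + j) (1 : F) ∈
      Finsupp.supported F F {q | G.weight w q + 2 ≤ G.weight w (G.ext U b m, G.rank w + j)} :=
    fun i hi h1 h2 => Finsupp.single_mem_supported F _ (weight_gen_lt U j h i hi h1 h2)
  have e1 : G.rank b - m = G.rank w := by omega
  have e2 : G.rank b - (m + 1) = G.rank w - 1 := by omega
  rw [gen, ← Finset.add_sum_erase _ _ (a := m) (Finset.mem_range.mpr (by omega)), e1,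
    add_sub_cancel_left]
  split_ifs with h0
  · rw [← Finset.add_sum_erase _ _ (a := m + 1)
      (Finset.mem_erase.mpr ⟨by omega, Finset.mem_range.mpr (by omega)⟩), e2, add_sub_cancel_left]
    refine Submodule.sum_mem _ fun i hi => ?_
    simp only [Finset.mem_erase, Finset.mem_range] at hi
    exact hterm i (by omega) hi.2.1 hi.1
  · rw [sub_zero]
    refine Submodule.sum_mem _ fun i hi => ?_
    simp only [Finset.mem_erase, Finset.mem_range] at hi
    exact hterm i (by omega) hi.1 (by omega)

theorem tri_single_of_lt {w : G.V} {p : G.Word × ℕ} (h : p.2 < G.rank w) :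
    G.tri F w (Finsupp.single p 1) = Finsupp.single p 1 := by
  simp [tri, h]

theorem tri_single_of_le {w : G.V} (W : G.Word) (j : ℕ) :
    G.tri F w (Finsupp.single (W, G.rank w + j) 1) =
      G.gen F (G.base W w).1 (G.base W w).2 j := by
  simp [tri]

theorem tri_sub_leading_mem (W : G.Word) (w : G.V) (j : ℕ) :
    G.tri F w (Finsupp.single (W, G.rank w + j) 1) - Finsupp.single (W, G.rank w + j) 1 -
      (if 0 < G.rank w then Finsupp.single (G.app W w, G.rank w - 1 + j) 1 else 0) ∈
    Finsupp.supported F F {q | G.weight w q + 2 ≤ G.weight w (W, G.rank w + j)} := by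
  obtain ⟨-, h2, h3⟩ := base_spec W w
  have := gen_sub_leading_mem (F := F) (G.base W w).1 j (rank_le_of_reflTransGen h2).1
  rwa [h3, ← tri_single_of_le] at this

theorem weight_app (W : G.Word) (w : G.V) (j : ℕ) (h0 : 0 < G.rank w) :
    G.weight w (G.app W w, G.rank w - 1 + j) + 1 = G.weight w (W, G.rank w + j) := by
  obtain ⟨-, h2, h3⟩ := base_spec W w
  have := weight_gen_succ (G.base W w).1 j (rank_le_of_reflTransGen h2).1 h0
  rwa [h3] at this

theorem tri_sub_mem (w : G.V) (p : G.Word × ℕ) :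
    G.tri F w (Finsupp.single p 1) - Finsupp.single p 1 ∈
      Finsupp.supported F F {q | G.weight w q < G.weight w p} := by
  rcases lt_or_ge p.2 (G.rank w) with h | h
  · simp [tri_single_of_lt h]
  · obtain ⟨W, n⟩ := p
    obtain ⟨j, rfl⟩ := Nat.exists_eq_add_of_le h
    rw [← sub_add_cancel (G.tri F w _ - _)
      (if 0 < G.rank w then Finsupp.single (G.app W w, G.rank w - 1 + j) (1 : F) else 0)]
    refine Submodule.add_mem _ (Finsupp.supported_mono ?_ (tri_sub_leading_mem W w j)) ?_
    · intro q hq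
      simp only [Set.mem_ofPred_eq] at hq ⊢
      omega
    · split_ifs with h0
      · refine Finsupp.single_mem_supported F _ ?_
        have := weight_app W w j h0
        simp only [Set.mem_ofPred_eq]
        omega
      · exact Submodule.zero_mem _

theorem tri_eq_self {w : G.V} {x : (G.Word × ℕ) →₀ F}
    (hx : x ∈ Finsupp.supported F F {p | p.2 < G.rank w}) : G.tri F w x = x := by
  rw [Finsupp.supported_eq_span_single] at hx
  refine LinearMap.eqOn_span (f := G.tri F w) (g := LinearMap.id) ?_ hx
  rintro _ ⟨p, hp, rfl⟩
  exact tri_single_of_lt hp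

theorem ker_eq_map (w : G.V) :
    G.ker F w = (Finsupp.supported F F {p : G.Word × ℕ | G.rank w ≤ p.2}).map (G.tri F w) := by
  rw [Finsupp.supported_eq_span_single, Submodule.map_span, ker]
  congr 1
  ext x
  constructor
  · rintro ⟨U, b, j, hb, hU, rfl⟩
    refine ⟨_, ⟨(G.ext U b (G.rank b - G.rank w), G.rank w + j), Nat.le_add_right _ _, rfl⟩, ?_⟩
    rw [tri_single_of_le, base_ext hU hb]
  · rintro ⟨_, ⟨⟨W, n⟩, hp, rfl⟩, rfl⟩
    obtain ⟨j, rfl⟩ := Nat.exists_eq_add_of_le (show G.rank w ≤ n from hp)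
    obtain ⟨h1, h2, -⟩ := base_spec W w
    exact ⟨_, _, j, h2, h1, tri_single_of_le W j⟩

theorem eq_zero_of_mem_ker {w : G.V} {x : (G.Word × ℕ) →₀ F} (hx : x ∈ G.ker F w)
    (hx' : x ∈ Finsupp.supported F F {p | p.2 < G.rank w}) : x = 0 := by
  rw [ker_eq_map] at hx
  obtain ⟨y, hy, hyx⟩ := hx
  have hinj := (Finsupp.unitriangular_bijective (G.weight w) _ (tri_sub_mem (F := F) w)).1
  obtain rfl : y = x := hinj (hyx.trans (tri_eq_self hx').symm)
  refine Submodule.disjoint_def.mp (Finsupp.disjoint_supported_supported ?_) y hy hx'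
  exact Set.disjoint_left.mpr fun p hp hp' => absurd (show p.2 < G.rank w from hp') (not_lt.mpr hp)

theorem ker_mono {v w : G.V} (h : G.adj v w) : G.ker F v ≤ G.ker F w := by
  refine Submodule.span_mono ?_
  rintro _ ⟨U, b, j, hb, hU, rfl⟩
  exact ⟨U, b, j, hb.tail h, hU, rfl⟩

variable (G F) in
/-- Multiplication by `s`. -/
def shift : ((G.Word × ℕ) →₀ F) →ₗ[F] ((G.Word × ℕ) →₀ F) :=
  Finsupp.lmapDomain F F fun p => (p.1, p.2 + 1)

theorem shift_mem_ker {w : G.V} {x : (G.Word × ℕ) →₀ F} (hx : x ∈ G.ker F w) :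
    G.shift F x ∈ G.ker F w := by
  suffices G.ker F w ≤ (G.ker F w).comap (G.shift F) from this hx
  refine Submodule.span_le.mpr ?_
  rintro _ ⟨U, b, j, hb, hU, rfl⟩
  refine Submodule.subset_span ⟨U, b, j + 1, hb, hU, ?_⟩
  simp [gen, shift, add_assoc, Finsupp.mapDomain_single]

variable (G F) in
/-- The coefficient of `s^n`. -/
def coef (n : ℕ) : ((G.Word × ℕ) →₀ F) →ₗ[F] (G.Word →₀ F) :=
  Finsupp.lcomapDomain (fun W => (W, n)) fun _ _ h => (Prod.mk.inj h).1

theorem coef_apply (n : ℕ) (x : (G.Word × ℕ) →₀ F) (W : G.Word) :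
    G.coef F n x W = x (W, n) := rfl

theorem coef_single_self (n : ℕ) (W : G.Word) (c : F) :
    G.coef F n (Finsupp.single (W, n) c) = Finsupp.single W c := by
  classical
  ext W'
  simp [coef_apply, Finsupp.single_apply]

theorem coef_shift (n : ℕ) (x : (G.Word × ℕ) →₀ F) :
    G.coef F (n + 1) (G.shift F x) = G.coef F n x := by
  ext W
  exact Finsupp.mapDomain_apply (f := fun p : G.Word × ℕ => (p.1, p.2 + 1))
    (fun p q h => by simpa [Prod.ext_iff] using h) x (W, n)

theorem coef_zero_shift (x : (G.Word × ℕ) →₀ F) : G.coef F 0 (G.shift F x) = 0 := by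
  ext W
  exact Finsupp.mapDomain_of_notMem_range _ _ (by simp)

theorem coef_eq_zero {d n : ℕ} (h : d ≤ n) {x : (G.Word × ℕ) →₀ F}
    (hx : x ∈ Finsupp.supported F F {p | p.2 < d}) : G.coef F n x = 0 := by
  ext W
  rw [coef_apply]
  exact (Finsupp.mem_supported' F x).mp hx (W, n) (not_lt.mpr h)

theorem mem_supported_of_coef {d : ℕ} {x : (G.Word × ℕ) →₀ F}
    (hx : ∀ n, d ≤ n → G.coef F n x = 0) : x ∈ Finsupp.supported F F {p | p.2 < d} := by
  refine (Finsupp.mem_supported' F x).mpr ?_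
  rintro ⟨W, n⟩ h
  exact DFunLike.congr_fun (hx n (not_lt.mp h)) W

theorem exists_division (W : G.Word) (w : G.V) :
    ∃ r ∈ Finsupp.supported F F {p : G.Word × ℕ | p.2 < G.rank w},
      Finsupp.single (W, G.rank w) 1 + r ∈ G.ker F w ∧
      (0 < G.rank w → G.coef F (G.rank w - 1) r - Finsupp.single (G.app W w) 1 ∈
        Finsupp.supported F F {W' | G.wdeg W' < G.wdeg W + G.rank w}) := by
  classical
  obtain ⟨z, hz, hTz⟩ := (Finsupp.unitriangular_bijective (G.weight w) _
    (tri_sub_mem (F := F) w)).2 (G.weight w (W, G.rank w) - 1) _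
    (Finsupp.supported_mono (fun q hq => by
      simp only [Set.mem_ofPred_eq, add_zero] at hq ⊢; omega) (tri_sub_leading_mem W w 0))
  simp only [add_zero] at hTz
  set a : (G.Word × ℕ) →₀ F :=
    if 0 < G.rank w then Finsupp.single (G.app W w, G.rank w - 1) 1 else 0 with ha
  have hamem : a ∈ Finsupp.supported F F {p : G.Word × ℕ | p.2 < G.rank w} := by
    rw [ha]
    split_ifs with h0
    · exact Finsupp.single_mem_supported F _ (show G.rank w - 1 < G.rank w by omega)
    · exact Submodule.zero_mem _
  set z₁ := z.filter fun p => p.2 < G.rank w with hz₁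
  set z₂ := z.filter fun p => ¬ p.2 < G.rank w with hz₂
  have hz12 : z₁ + z₂ = z := Finsupp.filter_add_filter_not z _
  have hz₁mem : z₁ ∈ Finsupp.supported F F {p : G.Word × ℕ | p.2 < G.rank w} :=
    (Finsupp.mem_supported' F _).mpr fun p hp => Finsupp.filter_apply_neg _ _ hp
  have hz₂mem : z₂ ∈ Finsupp.supported F F {p : G.Word × ℕ | G.rank w ≤ p.2} :=
    (Finsupp.mem_supported' F _).mpr fun p hp => Finsupp.filter_apply_neg _ _ (by simpa using hp)
  refine ⟨a + z₁, Submodule.add_mem _ hamem hz₁mem, ?_, fun h0 => ?_⟩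
  · rw [ker_eq_map]
    refine ⟨Finsupp.single (W, G.rank w) 1 - z₂, Submodule.sub_mem _
      (Finsupp.single_mem_supported F _ (le_refl (G.rank w))) hz₂mem, ?_⟩
    rw [← hz12, map_add, tri_eq_self hz₁mem] at hTz
    rw [map_sub, eq_sub_of_add_eq' hTz]
    abel
  · rw [map_add, ha, if_pos h0, coef_single_self, add_sub_cancel_left]
    refine (Finsupp.mem_supported' F _).mpr fun W' hW' => ?_
    rw [coef_apply, hz₁, Finsupp.filter_apply_pos (fun p : G.Word × ℕ => p.2 < G.rank w) _
      (show G.rank w - 1 < G.rank w by omega)]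
    refine (Finsupp.mem_supported' F _).mp hz _ ?_
    obtain ⟨c, hc⟩ : ∃ c, G.rank w = c + 1 := ⟨G.rank w - 1, by omega⟩
    simp only [weight, Set.mem_ofPred_eq, hc, Nat.add_sub_cancel] at hW' ⊢
    have : (3 * (c + 1) + 1) * (c + 1) = (3 * (c + 1) + 1) * c + (3 * (c + 1) + 1) := by ring
    omega

end LayeredGraph
end

noncomputable section
namespace LayeredGraph

variable {G : LayeredGraph} {F : Type} [Field F]

theorem coef_single_of_ne {m n : ℕ} (h : m ≠ n) (W : G.Word) (c : F) :
    G.coef F n (Finsupp.single (W, m) c) = 0 := by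
  classical
  ext W'
  simp [coef_apply, h]

variable (G F) in
/-- The lift of `x` to `ker w` with leading coefficient `x` in degree `|w|`. -/
def monicLift (w : G.V) : (G.Word →₀ F) →ₗ[F] ((G.Word × ℕ) →₀ F) :=
  Finsupp.linearCombination F fun W =>
    Finsupp.single (W, G.rank w) 1 + (exists_division (F := F) W w).choose

variable (G F) in
/-- The (right) action of the vertex `w` on formal combinations of words. -/
def act (w : G.V) : Module.End F (G.Word →₀ F) :=
  if 0 < G.rank w then G.coef F (G.rank w - 1) ∘ₗ G.monicLift F w else 0

theorem monicLift_single (w : G.V) (W : G.Word) :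
    G.monicLift F w (Finsupp.single W 1) =
      Finsupp.single (W, G.rank w) 1 + (exists_division (F := F) W w).choose := by
  simp [monicLift]

theorem monicLift_mem_ker (w : G.V) (x : G.Word →₀ F) : G.monicLift F w x ∈ G.ker F w := by
  rw [monicLift, Finsupp.linearCombination_apply]
  exact Submodule.sum_mem _ fun W _ =>
    Submodule.smul_mem _ _ (exists_division (F := F) W w).choose_spec.2.1

theorem coef_monicLift_of_lt {w : G.V} {n : ℕ} (h : G.rank w < n) (x : G.Word →₀ F) :
    G.coef F n (G.monicLift F w x) = 0 := by
  suffices G.coef F n ∘ₗ G.monicLift F w = 0 from LinearMap.congr_fun this x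
  refine Finsupp.lhom_ext' fun W => LinearMap.ext_ring ?_
  simp only [LinearMap.comp_apply, Finsupp.lsingle_apply, monicLift_single, map_add,
    LinearMap.zero_apply]
  rw [coef_single_of_ne h.ne, coef_eq_zero h.le (exists_division (F := F) W w).choose_spec.1,
    add_zero]

theorem coef_monicLift_rank (w : G.V) (x : G.Word →₀ F) :
    G.coef F (G.rank w) (G.monicLift F w x) = x := by
  suffices G.coef F (G.rank w) ∘ₗ G.monicLift F w = LinearMap.id from LinearMap.congr_fun this x
  refine Finsupp.lhom_ext' fun W => LinearMap.ext_ring ?_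
  simp only [LinearMap.comp_apply, Finsupp.lsingle_apply, monicLift_single, map_add,
    LinearMap.id_apply]
  rw [coef_single_self, coef_eq_zero le_rfl (exists_division (F := F) W w).choose_spec.1,
    add_zero]

theorem coef_monicLift_of_rank_eq_succ {w : G.V} {n : ℕ} (h : G.rank w = n + 1)
    (x : G.Word →₀ F) : G.coef F n (G.monicLift F w x) = G.act F w x := by
  simp [act, h]

theorem act_of_rank_eq_zero {w : G.V} (h : G.rank w = 0) : G.act F w = 0 := by
  simp [act, h]

theorem act_single_sub_mem {w : G.V} (h : G.rank w ≠ 0) (W : G.Word) :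
    G.act F w (Finsupp.single W 1) - Finsupp.single (G.app W w) 1 ∈
      Finsupp.supported F F {W' | G.wdeg W' < G.wdeg W + G.rank w} := by
  have h0 := Nat.pos_of_ne_zero h
  rw [act, if_pos h0, LinearMap.comp_apply, monicLift_single, map_add,
    coef_single_of_ne (by omega), zero_add]
  exact (exists_division (F := F) W w).choose_spec.2.2 h0

theorem monicLift_tail (e : G.E) (x : G.Word →₀ F) :
    G.monicLift F (G.tail e) x = G.shift F (G.monicLift F (G.head e) x) +
      G.monicLift F (G.head e) ((G.act F (G.tail e) - G.act F (G.head e)) x) := by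
  have hr := G.rank_tail e
  rw [← sub_eq_zero]
  refine eq_zero_of_mem_ker (w := G.head e) (Submodule.sub_mem _
    (ker_mono ⟨e, rfl, rfl⟩ (monicLift_mem_ker _ x)) (Submodule.add_mem _
      (shift_mem_ker (monicLift_mem_ker _ x)) (monicLift_mem_ker _ _)))
    (mem_supported_of_coef fun n hn => ?_)
  rw [map_sub, map_add]
  rcases hn.eq_or_lt with rfl | hlt
  · rw [coef_monicLift_of_rank_eq_succ hr, coef_monicLift_rank]
    rcases h : G.rank (G.head e) with _ | m
    · rw [coef_zero_shift, act_of_rank_eq_zero h]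
      simp
    · rw [coef_shift, coef_monicLift_of_rank_eq_succ h]
      simp
  · obtain ⟨n, rfl⟩ : ∃ m, n = m + 1 := ⟨n - 1, by omega⟩
    rw [coef_shift, coef_monicLift_of_lt hlt, add_zero]
    rcases (show G.rank (G.head e) ≤ n by omega).eq_or_lt with rfl | hlt'
    · rw [← hr, coef_monicLift_rank, coef_monicLift_rank, sub_self]
    · rw [coef_monicLift_of_lt (by omega), coef_monicLift_of_lt hlt', sub_self]

open Polynomial MulOpposite

variable (G F) in
/-- The monic polynomial of degree `|w|` whose coefficients are those of `monicLift w`. -/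
def monicPoly (w : G.V) : (Module.End F (G.Word →₀ F))ᵐᵒᵖ[X] :=
  ∑ i ∈ Finset.range (G.rank w + 1), monomial i (op (G.coef F i ∘ₗ G.monicLift F w))

theorem coeff_monicPoly (w : G.V) (i : ℕ) :
    (G.monicPoly F w).coeff i = op (G.coef F i ∘ₗ G.monicLift F w) := by
  simp only [monicPoly, finsetSum_coeff, coeff_monomial, Finset.sum_ite_eq', Finset.mem_range]
  split_ifs with h
  · rfl
  · rw [eq_comm, op_eq_zero_iff]
    exact LinearMap.ext fun x => coef_monicLift_of_lt (by omega) x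

theorem monic_monicPoly (w : G.V) : (G.monicPoly F w).Monic := by
  refine monic_of_natDegree_le_of_coeff_eq_one (G.rank w)
    (natDegree_le_iff_coeff_eq_zero.mpr fun n hn => ?_) ?_
  · rw [coeff_monicPoly, op_eq_zero_iff]
    exact LinearMap.ext fun x => coef_monicLift_of_lt hn x
  · rw [coeff_monicPoly, op_eq_one_iff]
    exact LinearMap.ext fun x => coef_monicLift_rank w x

theorem monicPoly_tail (e : G.E) :
    G.monicPoly F (G.tail e) =
      (X + C (op (G.act F (G.tail e) - G.act F (G.head e)))) * G.monicPoly F (G.head e) := by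
  ext1 i
  rw [add_mul, coeff_add, coeff_C_mul, coeff_monicPoly, coeff_monicPoly]
  rcases i with _ | i
  · rw [coeff_X_mul_zero, zero_add, ← op_mul]
    congr 1
    refine LinearMap.ext fun x => ?_
    rw [LinearMap.comp_apply, monicLift_tail e, map_add, coef_zero_shift, zero_add]
    rfl
  · rw [coeff_X_mul, coeff_monicPoly, ← op_mul, ← op_add]
    congr 1
    refine LinearMap.ext fun x => ?_
    rw [LinearMap.comp_apply, monicLift_tail e, map_add, coef_shift]
    rfl

variable (G F) in
/-- The action of `T(V⁺)` on formal combinations of words. -/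
def actHom : FreeAlgebra F G.Vp →ₐ[F] (Module.End F (G.Word →₀ F))ᵐᵒᵖ :=
  FreeAlgebra.lift F fun p => op (G.act F p.1)

theorem actHom_vert (v : G.V) : G.actHom F (G.vert F v) = op (G.act F v) := by
  rw [vert]
  split_ifs with h
  · rw [map_zero, act_of_rank_eq_zero h, op_zero]
  · exact FreeAlgebra.lift_ι_apply _ _

theorem theta_ι (e : G.E) :
    G.theta F (FreeAlgebra.ι F e) = G.vert F (G.tail e) - G.vert F (G.head e) := by
  simp [theta]

/-- `G.IsWalk v π u`: the possibly empty list of edges `π` is a path from `v` to `u`. -/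
def IsWalk (G : LayeredGraph) (v : G.V) : List G.E → G.V → Prop
  | [], u => v = u
  | e :: π, u => G.tail e = v ∧ G.IsWalk (G.head e) π u

theorem IsWalk.length {v u : G.V} {π : List G.E} (h : G.IsWalk v π u) :
    π.length + G.rank u = G.rank v := by
  induction π generalizing v with
  | nil => obtain rfl : v = u := h; simp
  | cons e π ih =>
    obtain ⟨rfl, h⟩ := h
    have := ih h
    have := G.rank_tail e
    simp only [List.length_cons]
    omega

theorem IsWalk.append {v u w : G.V} {π σ : List G.E} (h : G.IsWalk v π u) (h' : G.IsWalk u σ w) :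
    G.IsWalk v (π ++ σ) w := by
  induction π generalizing v with
  | nil => obtain rfl : v = u := h; exact h'
  | cons e π ih => exact ⟨h.1, ih h.2⟩

theorem isPathList_iff {π : List G.E} :
    G.IsPathList π ↔ π ≠ [] ∧ π.IsChain fun e f => G.head e = G.tail f := Iff.rfl

theorem isWalk_cons_iff {v u : G.V} {e : G.E} {π : List G.E} :
    G.IsWalk v (e :: π) u ↔ G.IsPathList (e :: π) ∧ G.firstV (e :: π) = some v ∧
      G.lastV (e :: π) = some u := by
  induction π generalizing v e with
  | nil => simp [IsWalk, isPathList_iff, firstV, lastV]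
  | cons f π ih =>
    rw [IsWalk, ih]
    simp [isPathList_iff, firstV, lastV, List.isChain_cons_cons]
    tauto

theorem exists_isWalk_of_isPathList {π : List G.E} (h : G.IsPathList π) :
    ∃ v u, G.IsWalk v π u ∧ G.firstV π = some v ∧ G.lastV π = some u := by
  rcases π with _ | ⟨e, π⟩
  · exact absurd rfl h.1
  · obtain ⟨u, hu⟩ : ∃ u, G.lastV (e :: π) = some u := by
      simp [lastV, List.getLast?_cons]
    exact ⟨G.tail e, u, isWalk_cons_iff.mpr ⟨h, rfl, hu⟩, rfl, hu⟩

theorem exists_isWalk_of_reflTransGen {v u : G.V} (h : Relation.ReflTransGen G.adj v u) :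
    ∃ π, G.IsWalk v π u := by
  induction h using Relation.ReflTransGen.head_induction_on with
  | refl => exact ⟨[], rfl⟩
  | head hadj _ ih =>
    obtain ⟨e, rfl, rfl⟩ := hadj
    obtain ⟨π, hπ⟩ := ih
    exact ⟨e :: π, rfl, hπ⟩

theorem exists_isWalk_rank_zero (hfull : G.EdgeFull) (v : G.V) :
    ∃ π u, G.IsWalk v π u ∧ G.rank u = 0 := by
  induction h : G.rank v generalizing v with
  | zero => exact ⟨[], v, rfl, h⟩
  | succ n ih =>
    obtain ⟨e, rfl⟩ := hfull v (by omega)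
    have := G.rank_tail e
    obtain ⟨π, u, hπ, hu⟩ := ih (G.head e) (by omega)
    exact ⟨e :: π, u, ⟨rfl, hπ⟩, hu⟩

theorem map_ecoef {A : Type*} [Ring A] [Algebra F A] (φ : FreeAlgebra F G.E →ₐ[F] A)
    (π : List G.E) (k : ℕ) : φ (G.ecoef F π k) = ((-1 : F) ^ k) •
      ((π.sublistsLen k).map fun l => (l.map fun e => φ (FreeAlgebra.ι F e)).prod).sum := by
  rw [ecoef, map_smul, map_list_sum, List.map_map]
  simp only [Function.comp_def, map_list_prod, List.map_map]

/-- An algebra homomorphism out of `T(E)` kills the ideal `R` as soon as there are monic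
polynomials attached to the vertices which are compatible with the edges. -/
theorem map_eq_zero_of_mem_Rideal {A : Type*} [Ring A] [Algebra F A]
    (φ : FreeAlgebra F G.E →ₐ[F] A) (P : G.V → A[X]) (hP : ∀ v, (P v).Monic)
    (hPe : ∀ e, P (G.tail e) = (X + C (φ (FreeAlgebra.ι F e))) * P (G.head e))
    {x : FreeAlgebra F G.E} (hx : x ∈ G.Rideal F) : φ x = 0 := by
  have hwalk : ∀ {v u : G.V} {π : List G.E}, G.IsWalk v π u →
      P v = (π.map fun e => (X + C (φ (FreeAlgebra.ι F e)))).prod * P u := by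
    intro v u π h
    induction π generalizing v with
    | nil => obtain rfl : v = u := h; simp
    | cons e π ih =>
      obtain ⟨rfl, h⟩ := h
      rw [hPe, ih h, List.map_cons, List.prod_cons, mul_assoc]
  suffices G.Rideal F ≤ LinearMap.ker φ.toLinearMap from this hx
  refine Submodule.span_le.mpr ?_
  rintro _ ⟨a, _, b, ⟨π₁, π₂, k, h₁, h₂, hf, hl, -, hk, rfl⟩, rfl⟩
  obtain ⟨v, u, hw₁, hv₁, hu₁⟩ := exists_isWalk_of_isPathList h₁
  obtain ⟨v', u', hw₂, hv₂, hu₂⟩ := exists_isWalk_of_isPathList h₂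
  obtain rfl : v = v' := by rw [hv₁, hv₂] at hf; exact Option.some.inj hf
  obtain rfl : u = u' := by rw [hu₁, hu₂] at hl; exact Option.some.inj hl
  have hlen := hw₁.length.trans hw₂.length.symm
  have hprod := (hP u).isRegular.right ((hwalk hw₁).symm.trans (hwalk hw₂))
  have hcoef := congr_arg (fun p => p.coeff (π₁.length - k)) hprod
  rw [(coeff_list_prod_X_add_C _ π₁).2 _ k (by omega),
    (coeff_list_prod_X_add_C _ π₂).2 _ k (by omega)] at hcoef
  have key : φ (G.ecoef F π₁ k) = φ (G.ecoef F π₂ k) := by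
    rw [map_ecoef, map_ecoef, hcoef]
  simp [key]

theorem actHom_theta_eq_zero {x : FreeAlgebra F G.E} (hx : x ∈ G.Rideal F) :
    G.actHom F (G.theta F x) = 0 := by
  refine map_eq_zero_of_mem_Rideal (A := (Module.End F (G.Word →₀ F))ᵐᵒᵖ)
    ((G.actHom F).comp (G.theta F)) (G.monicPoly F)
    (fun v => monic_monicPoly v) (fun e => ?_) hx
  rw [monicPoly_tail, AlgHom.comp_apply, theta_ι, map_sub, actHom_vert, actHom_vert, op_sub]

variable (G F) in
/-- The action of `T(V⁺)` by appending vertices to words, the leading part of `actHom`. -/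
def appHom : FreeAlgebra F G.Vp →ₐ[F] (Module.End F (G.Word →₀ F))ᵐᵒᵖ :=
  FreeAlgebra.lift F fun p => op (Finsupp.lmapDomain F F fun W => G.app W p.1)

theorem appHom_word (l : List G.Vp) (W : G.Word) :
    (G.appHom F (l.map (FreeAlgebra.ι F)).prod).unop (Finsupp.single W 1) =
      Finsupp.single (l.foldl (fun W p => G.app W p.1) W) 1 := by
  induction l generalizing W with
  | nil => simp
  | cons p l ih => simp [appHom, Finsupp.mapDomain_single, ← ih]

theorem wdeg_foldl_app (l : List G.Vp) (W : G.Word) :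
    G.wdeg (l.foldl (fun W p => G.app W p.1) W) =
      G.wdeg W + (l.map fun p => G.rank p.1).sum := by
  induction l generalizing W with
  | nil => simp
  | cons p l ih => simp [ih, wdeg_app, add_assoc]

theorem actHom_word_sub_appHom_word_mem (l : List G.Vp) :
    (∀ W, (G.actHom F (l.map (FreeAlgebra.ι F)).prod).unop (Finsupp.single W 1) -
        (G.appHom F (l.map (FreeAlgebra.ι F)).prod).unop (Finsupp.single W 1) ∈
      Finsupp.supported F F {W' | G.wdeg W' < G.wdeg W + (l.map fun p => G.rank p.1).sum}) ∧
    ∀ n, ∀ x ∈ Finsupp.supported F F {W' | G.wdeg W' < n},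
      (G.actHom F (l.map (FreeAlgebra.ι F)).prod).unop x ∈
        Finsupp.supported F F {W' | G.wdeg W' < n + (l.map fun p => G.rank p.1).sum} := by
  have extend : ∀ l : List G.Vp, (∀ W, (G.actHom F (l.map (FreeAlgebra.ι F)).prod).unop
        (Finsupp.single W 1) - (G.appHom F (l.map (FreeAlgebra.ι F)).prod).unop
        (Finsupp.single W 1) ∈
      Finsupp.supported F F {W' | G.wdeg W' < G.wdeg W + (l.map fun p => G.rank p.1).sum}) →
      ∀ n, ∀ x ∈ Finsupp.supported F F {W' | G.wdeg W' < n},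
      (G.actHom F (l.map (FreeAlgebra.ι F)).prod).unop x ∈
        Finsupp.supported F F {W' | G.wdeg W' < n + (l.map fun p => G.rank p.1).sum} := by
    intro l h n x hx
    rw [Finsupp.supported_eq_span_single] at hx
    refine (Submodule.map_span_le _ _ _).mpr ?_ (Submodule.mem_map_of_mem hx)
    rintro _ ⟨W, hW, rfl⟩
    have hW : G.wdeg W < n := hW
    rw [← sub_add_cancel ((G.actHom F _).unop _)
      ((G.appHom F (l.map (FreeAlgebra.ι F)).prod).unop (Finsupp.single W 1))]
    refine Submodule.add_mem _ (Finsupp.supported_mono ?_ (h W)) ?_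
    · intro W' hW'
      simp only [Set.mem_ofPred_eq] at hW' ⊢
      omega
    · rw [appHom_word]
      refine Finsupp.single_mem_supported F _ ?_
      simp only [Set.mem_ofPred_eq, wdeg_foldl_app]
      omega
  suffices h : _ from ⟨h, extend l h⟩
  induction l with
  | nil => intro W; simp
  | cons p l ih =>
    intro W
    have h1 : (G.actHom F ((p :: l).map (FreeAlgebra.ι F)).prod).unop (Finsupp.single W 1) =
        (G.actHom F (l.map (FreeAlgebra.ι F)).prod).unop (G.act F p.1 (Finsupp.single W 1)) := by
      simp [actHom]
    have h2 : (G.appHom F ((p :: l).map (FreeAlgebra.ι F)).prod).unop (Finsupp.single W 1) =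
        (G.appHom F (l.map (FreeAlgebra.ι F)).prod).unop (Finsupp.single (G.app W p.1) 1) := by
      simp [appHom, Finsupp.mapDomain_single]
    have h3 := Submodule.add_mem _
      (extend l ih _ _ (act_single_sub_mem (F := F) p.2 W)) (wdeg_app W p.1 ▸ ih (G.app W p.1))
    rw [h1, h2, List.map_cons, List.sum_cons, ← add_assoc]
    rwa [map_sub, sub_add_sub_cancel] at h3

end LayeredGraph
end

noncomputable section
namespace LayeredGraph

variable {G : LayeredGraph} {F : Type} [Field F]

theorem mul_mem_twoSidedSpan {A : Type} [Ring A] [Algebra F A] {S : Set A} {x : A}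
    (hx : x ∈ twoSidedSpan F S) (a b : A) : a * x * b ∈ twoSidedSpan F S := by
  induction hx using Submodule.span_induction with
  | mem x h =>
    obtain ⟨a', s, b', hs, rfl⟩ := h
    exact Submodule.subset_span ⟨a * a', s, b' * b, hs, by simp only [mul_assoc]⟩
  | zero => simp
  | add x y _ _ hx hy =>
    rw [mul_add, add_mul]
    exact Submodule.add_mem _ hx hy
  | smul c x _ hx =>
    rw [mul_smul_comm, smul_mul_assoc]
    exact Submodule.smul_mem _ _ hx

theorem mem_twoSidedSpan_of_mem {A : Type} [Ring A] [Algebra F A] {S : Set A} {x : A}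
    (hx : x ∈ S) : x ∈ twoSidedSpan F S :=
  Submodule.subset_span ⟨1, x, 1, hx, by simp⟩

variable (G F) in
/-- The span of the monomials in `T(V⁺)` whose degree satisfies `p`. -/
def degSpan (p : ℕ → Prop) : Submodule F (FreeAlgebra F G.Vp) :=
  Submodule.span F {x | ∃ l : List G.Vp, p (l.map fun p => G.rank p.1).sum ∧
    x = (l.map (FreeAlgebra.ι F)).prod}

theorem homogV_eq_degSpan (k : ℕ) : G.homogV F k = G.degSpan F (· = k) := rfl

theorem degSpan_mono {p q : ℕ → Prop} (h : ∀ n, p n → q n) : G.degSpan F p ≤ G.degSpan F q :=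
  Submodule.span_mono fun _ ⟨l, hl, hx⟩ => ⟨l, h _ hl, hx⟩

theorem mul_mem_degSpan {p q r : ℕ → Prop} (h : ∀ i j, p i → q j → r (i + j))
    {x y : FreeAlgebra F G.Vp} (hx : x ∈ G.degSpan F p) (hy : y ∈ G.degSpan F q) :
    x * y ∈ G.degSpan F r := by
  have : G.degSpan F p * G.degSpan F q ≤ G.degSpan F r := by
    rw [degSpan, degSpan, Submodule.span_mul_span]
    refine Submodule.span_mono ?_
    rintro _ ⟨_, ⟨l, hl, rfl⟩, _, ⟨l', hl', rfl⟩, rfl⟩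
    refine ⟨l ++ l', ?_, ?_⟩
    · rw [List.map_append, List.sum_append]
      exact h _ _ hl hl'
    · rw [List.map_append, List.prod_append]
  exact this (Submodule.mul_mem_mul hx hy)

theorem degSpan_lt (k : ℕ) : ⨆ j, ⨆ _ : j < k, G.homogV F j = G.degSpan F (· < k) := by
  refine le_antisymm (iSup₂_le fun j hj => ?_) ?_
  · exact degSpan_mono (p := (· = j)) fun n hn => lt_of_eq_of_lt hn hj
  refine Submodule.span_le.mpr ?_
  rintro _ ⟨l, hl, rfl⟩
  exact Submodule.mem_iSup_of_mem _
    (Submodule.mem_iSup_of_mem hl (Submodule.subset_span ⟨l, rfl, rfl⟩))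

theorem degSpan_true : G.degSpan F (fun _ => True) = ⊤ := by
  refine eq_top_iff.mpr fun x _ => ?_
  induction x using FreeAlgebra.induction with
  | grade0 r =>
    rw [Algebra.algebraMap_eq_smul_one]
    exact Submodule.smul_mem _ _ (Submodule.subset_span ⟨[], trivial, by simp⟩)
  | grade1 p => exact Submodule.subset_span ⟨[p], trivial, by simp⟩
  | mul x y hx hy => exact mul_mem_degSpan (fun _ _ _ _ => trivial) (hx trivial) (hy trivial)
  | add x y hx hy => exact Submodule.add_mem _ (hx trivial) (hy trivial)

theorem vert_mem_degSpan (v : G.V) : G.vert F v ∈ G.degSpan F (· = G.rank v) := by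
  rw [vert]
  split_ifs with h
  · exact Submodule.zero_mem _
  · exact Submodule.subset_span ⟨[⟨v, h⟩], List.sum_singleton, List.prod_singleton.symm⟩

variable (G F) in
/-- The product of the tails of the first `k` edges of `π`. -/
def tailProd (π : List G.E) (k : ℕ) : FreeAlgebra F G.Vp :=
  ((π.take k).map fun e => G.vert F (G.tail e)).prod

theorem tailProd_cons_succ (e : G.E) (π : List G.E) (k : ℕ) :
    G.tailProd F (e :: π) (k + 1) = G.vert F (G.tail e) * G.tailProd F π k := by
  simp [tailProd]

theorem tailProd_append {π : List G.E} {k : ℕ} (hk : k ≤ π.length) (σ : List G.E) :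
    G.tailProd F (π ++ σ) k = G.tailProd F π k := by
  rw [tailProd, List.take_append_of_le_length hk, tailProd]

theorem IsWalk.pathVerts_take {v u : G.V} {π : List G.E} (h : G.IsWalk v π u) {k : ℕ}
    (hk : k ≤ π.length) : (G.pathVerts π).take k = (π.take k).map G.tail := by
  induction π generalizing v k with
  | nil => simp [pathVerts]
  | cons e π ih =>
    rcases k with _ | k
    · simp
    · simp only [List.length_cons, Nat.add_le_add_iff_right] at hk
      rcases π with _ | ⟨f, π⟩
      · obtain rfl : k = 0 := by simpa using hk
        simp [pathVerts]
      · have := ih h.2 hk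
        simp only [pathVerts, List.map_cons, List.take_succ_cons] at this ⊢
        rw [← this, h.2.1]

theorem vmon_eq_tailProd {v u : G.V} {π : List G.E} (h : G.IsWalk v π u) {k : ℕ}
    (hk : k ≤ π.length) : G.vmon F π k = G.tailProd F π k := by
  rw [vmon, h.pathVerts_take hk, List.map_map]
  rfl

theorem tailProd_sub_mem_Rgr {v u₁ u₂ : G.V} {π₁ π₂ : List G.E} (h₁ : G.IsWalk v π₁ u₁)
    (h₂ : G.IsWalk v π₂ u₂) {k : ℕ} (hk₁ : k ≤ π₁.length) (hk₂ : k ≤ π₂.length) :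
    G.tailProd F π₁ k - G.tailProd F π₂ k ∈ G.Rgr F := by
  rcases π₁ with _ | ⟨e₁, π₁⟩
  · obtain rfl : k = 0 := by simpa using hk₁
    simp [tailProd]
  rcases π₂ with _ | ⟨e₂, π₂⟩
  · obtain rfl : k = 0 := by simpa using hk₂
    simp [tailProd]
  rcases k with _ | _ | k
  · simp [tailProd]
  · simp [tailProd, h₁.1, h₂.1]
  · rw [← vmon_eq_tailProd h₁ hk₁, ← vmon_eq_tailProd h₂ hk₂]
    obtain ⟨hp₁, hf₁, -⟩ := isWalk_cons_iff.mp h₁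
    obtain ⟨hp₂, hf₂, -⟩ := isWalk_cons_iff.mp h₂
    exact mem_twoSidedSpan_of_mem
      ⟨_, _, k + 2, hp₁, hp₂, hf₁.trans hf₂.symm, by omega, hk₁, hk₂, rfl⟩

section Kernel

variable (hfull : G.EdgeFull)

/-- A chosen path from `v` to the bottom layer. -/
def descent (v : G.V) : List G.E := (exists_isWalk_rank_zero hfull v).choose

theorem exists_isWalk_descent (v : G.V) : ∃ u, G.IsWalk v (descent hfull v) u ∧ G.rank u = 0 :=
  (exists_isWalk_rank_zero hfull v).choose_spec

theorem length_descent (v : G.V) : (descent hfull v).length = G.rank v := by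
  obtain ⟨u, h, hu⟩ := exists_isWalk_descent hfull v
  have := h.length
  omega

variable (F) in
/-- The element of `T(V⁺)` represented by a word. -/
def wordElem : G.Word → FreeAlgebra F G.Vp
  | [] => 1
  | (b, m) :: U => wordElem U * G.tailProd F (descent hfull b) m

theorem tailProd_descent_one (w : G.V) (hw : G.rank w ≠ 0) :
    G.tailProd F (descent hfull w) 1 = G.vert F w := by
  obtain ⟨u, h, hu⟩ := exists_isWalk_descent hfull w
  have hl := length_descent hfull w
  rcases hd : descent hfull w with _ | ⟨e, π⟩
  · rw [hd] at hl
    exact absurd hl.symm hw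
  · rw [hd] at h
    simp [tailProd, h.1]

theorem tailProd_mul_vert {w : G.V} (π : List G.E) (hw : G.rank w ≠ 0) :
    G.tailProd F (π ++ descent hfull w) (π.length + 1) =
      G.tailProd F (π ++ descent hfull w) π.length * G.vert F w := by
  rw [← tailProd_descent_one hfull w hw]
  simp [tailProd, List.take_append, List.take_of_length_le]

theorem wordElem_mul_vert_sub_mem (W : G.Word) {w : G.V} (hw : G.rank w ≠ 0) :
    wordElem F hfull W * G.vert F w - wordElem F hfull (G.app W w) ∈ G.Rgr F := by
  by_cases hc : G.Comp W w
  · rcases W with _ | ⟨⟨b, m⟩, U⟩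
    · exact hc.elim
    · have hbase := base_of_comp hc
      obtain ⟨-, -, hbw, hr⟩ := hc
      have hm : G.rank b - G.rank w = m := by omega
      rw [app, hbase]
      simp only [hm, ext, wordElem]
      obtain ⟨π, hπ⟩ := exists_isWalk_of_reflTransGen hbw
      have hlen : π.length = m := by have := hπ.length; omega
      obtain ⟨u, hd, -⟩ := exists_isWalk_descent hfull b
      obtain ⟨u', hd', -⟩ := exists_isWalk_descent hfull w
      have hmul := tailProd_mul_vert (F := F) hfull π hw
      rw [hlen] at hmul
      have h1 := tailProd_sub_mem_Rgr (F := F) hd (hπ.append hd') (k := m)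
        (by rw [length_descent]; omega) (by rw [List.length_append]; omega)
      have h2 := tailProd_sub_mem_Rgr (F := F) (hπ.append hd') hd (k := m + 1)
        (by rw [List.length_append, length_descent]; omega) (by rw [length_descent]; omega)
      rw [hmul] at h2
      have h3 : _ ∈ G.Rgr F := Submodule.add_mem _
        (mul_mem_twoSidedSpan h1 (wordElem F hfull U) (G.vert F w))
        (mul_mem_twoSidedSpan h2 (wordElem F hfull U) 1)
      convert h3 using 1
      simp only [mul_sub, sub_mul, mul_one, mul_assoc]
      abel
  · rw [app, base_of_not_comp hc]
    simp [ext, wordElem, tailProd_descent_one hfull w hw]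

theorem sub_wordElem_mem_Rgr (x : FreeAlgebra F G.Vp) :
    x - Finsupp.linearCombination F (wordElem F hfull)
      ((G.appHom F x).unop (Finsupp.single [] 1)) ∈ G.Rgr F := by
  have hx : x ∈ G.degSpan F fun _ => True := degSpan_true (G := G) (F := F) ▸ trivial
  induction hx using Submodule.span_induction with
  | mem x h =>
    obtain ⟨l, -, rfl⟩ := h
    rw [appHom_word, Finsupp.linearCombination_single, one_smul]
    induction l using List.reverseRecOn with
    | nil => simp [wordElem]
    | append_singleton l p ih =>
      have h : _ ∈ G.Rgr F := Submodule.add_mem _ (mul_mem_twoSidedSpan ih 1 (FreeAlgebra.ι F p))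
        (wordElem_mul_vert_sub_mem (F := F) hfull (l.foldl (fun W p => G.app W p.1) []) p.2)
      have hp : G.vert F p.1 = FreeAlgebra.ι F p := dif_neg p.2
      rw [hp, one_mul, sub_mul, sub_add_sub_cancel] at h
      simpa only [List.map_append, List.prod_append, List.map_singleton, List.prod_singleton,
        List.foldl_append, List.foldl_cons, List.foldl_nil] using h
  | zero => simp
  | add x y _ _ hx hy =>
    rw [map_add, MulOpposite.unop_add, LinearMap.add_apply, map_add, add_sub_add_comm]
    exact Submodule.add_mem _ hx hy
  | smul c x _ hx =>
    rw [map_smul, MulOpposite.unop_smul, LinearMap.smul_apply, map_smul, ← smul_sub]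
    exact Submodule.smul_mem _ _ hx

end Kernel

theorem grIdeal_le_Rgr (hfull : G.EdgeFull) :
    G.grIdeal F (Submodule.map (G.theta F).toLinearMap (G.Rideal F)) ≤ G.Rgr F := by
  refine iSup_le fun k => ?_
  rintro x ⟨hxk, hx⟩
  rw [degSpan_lt] at hx
  obtain ⟨y, hy, _, ⟨r, hr, rfl⟩, rfl⟩ := Submodule.mem_sup.mp hx
  set x := y + (G.theta F).toLinearMap r with hxdef
  let ev : (Module.End F (G.Word →₀ F))ᵐᵒᵖ →ₗ[F] (G.Word →₀ F) :=
    (LinearMap.applyₗ (Finsupp.single [] 1)) ∘ₗ (MulOpposite.opLinearEquiv F).symm.toLinearMap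
  let Φ := ev ∘ₗ (G.actHom F).toLinearMap
  let Ψ := ev ∘ₗ (G.appHom F).toLinearMap
  have hΦΨ : ∀ z ∈ G.degSpan F (· = k), Φ z - Ψ z ∈
      Finsupp.supported F F {W | G.wdeg W < k} := by
    intro z hz
    refine (Submodule.map_span_le (Φ - Ψ) _ _).mpr ?_ (Submodule.mem_map_of_mem hz)
    rintro _ ⟨l, rfl, rfl⟩
    have h := (actHom_word_sub_appHom_word_mem (F := F) l).1 []
    rwa [show G.wdeg [] = 0 from rfl, zero_add] at h
  have hΨ : ∀ z ∈ G.degSpan F (· = k), Ψ z ∈ Finsupp.supported F F {W | G.wdeg W = k} := by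
    intro z hz
    refine (Submodule.map_span_le Ψ _ _).mpr ?_ (Submodule.mem_map_of_mem hz)
    rintro _ ⟨l, rfl, rfl⟩
    change (G.appHom F _).unop (Finsupp.single [] 1) ∈ _
    rw [appHom_word]
    refine Finsupp.single_mem_supported F _ ?_
    change G.wdeg _ = _
    rw [wdeg_foldl_app]
    exact zero_add _
  have hΦ : ∀ z ∈ G.degSpan F (· < k), Φ z ∈ Finsupp.supported F F {W | G.wdeg W < k} := by
    intro z hz
    refine (Submodule.map_span_le Φ _ _).mpr ?_ (Submodule.mem_map_of_mem hz)
    rintro _ ⟨l, hl, rfl⟩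
    refine Finsupp.supported_mono ?_ ((actHom_word_sub_appHom_word_mem (F := F) l).2 1
      (Finsupp.single [] 1) (Finsupp.single_mem_supported F _ (by simp [wdeg])))
    intro W hW
    simp only [Set.mem_ofPred_eq] at hW ⊢
    omega
  have hΦx : Φ x = Φ y := by
    rw [hxdef, map_add, add_eq_left]
    change ev (G.actHom F (G.theta F r)) = 0
    rw [actHom_theta_eq_zero hr, map_zero]
  have hΨx : Ψ x = 0 := by
    refine Submodule.disjoint_def.mp (Finsupp.disjoint_supported_supported
      (s := {W : G.Word | G.wdeg W = k}) (t := {W | G.wdeg W < k}) ?_) _ (hΨ x hxk) ?_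
    · exact Set.disjoint_left.mpr fun W hW hW' =>
        (show G.wdeg W < k from hW').ne (show G.wdeg W = k from hW)
    · rw [← sub_sub_self (Φ x) (Ψ x)]
      exact Submodule.sub_mem _ (hΦx ▸ hΦ y hy) (hΦΨ x hxk)
  have := sub_wordElem_mem_Rgr (F := F) hfull x
  rwa [show (G.appHom F x).unop (Finsupp.single [] 1) = 0 from hΨx, map_zero, sub_zero] at this

theorem vert_mem_range_theta (hfull : G.EdgeFull) (v : G.V) : G.vert F v ∈ (G.theta F).range := by
  obtain ⟨π, u, h, hu⟩ := exists_isWalk_rank_zero hfull v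
  induction π generalizing v with
  | nil =>
    obtain rfl : v = u := h
    rw [vert, dif_pos hu]
    exact zero_mem _
  | cons e π ih =>
    obtain ⟨rfl, h⟩ := h
    rw [← sub_add_cancel (G.vert F (G.tail e)) (G.vert F (G.head e)), ← theta_ι]
    exact add_mem ⟨_, rfl⟩ (ih _ h)

theorem theta_surjective (hfull : G.EdgeFull) : Function.Surjective (G.theta F) := by
  intro x
  change x ∈ (G.theta F).range
  induction x using FreeAlgebra.induction with
  | grade0 r => exact Subalgebra.algebraMap_mem _ r
  | grade1 p =>
    have := vert_mem_range_theta (F := F) hfull p.1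
    rwa [vert, dif_neg p.2] at this
  | mul x y hx hy => exact mul_mem hx hy
  | add x y hx hy => exact add_mem hx hy

/-- The leading term of `θ(e(π,k))` is, up to sign, the product of the first `k` tails. -/
theorem tailProd_leading {v u : G.V} {π : List G.E} (h : G.IsWalk v π u) {k : ℕ}
    (hk : k ≤ π.length) :
    G.tailProd F π k ∈ G.degSpan F (· = ∑ i ∈ Finset.range k, (G.rank v - i)) ∧
    ((π.sublistsLen k).map fun l =>
        (l.map fun e => G.theta F (FreeAlgebra.ι F e)).prod).sum - G.tailProd F π k ∈
      G.degSpan F (· < ∑ i ∈ Finset.range k, (G.rank v - i)) := by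
  induction π generalizing v k with
  | nil =>
    obtain rfl : k = 0 := by simpa using hk
    simp only [tailProd, List.take_nil, List.map_nil, List.prod_nil, List.sublistsLen_zero,
      List.map_cons, List.sum_cons, List.sum_nil, add_zero, sub_self]
    exact ⟨Submodule.subset_span ⟨[], by simp, by simp⟩, Submodule.zero_mem _⟩
  | cons e π ih =>
    obtain ⟨rfl, h⟩ := h
    rcases k with _ | k
    · simp only [tailProd, List.take_zero, List.map_nil, List.prod_nil, List.sublistsLen_zero,
        List.map_cons, List.sum_cons, List.sum_nil, add_zero, sub_self]
      exact ⟨Submodule.subset_span ⟨[], by simp, by simp⟩, Submodule.zero_mem _⟩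
    · simp only [List.length_cons, Nat.add_le_add_iff_right] at hk
      have hr := G.rank_tail e
      have hl := h.length
      have hD : ∑ i ∈ Finset.range (k + 1), (G.rank (G.tail e) - i) =
          ∑ i ∈ Finset.range k, (G.rank (G.head e) - i) + G.rank (G.tail e) := by
        rw [Finset.sum_range_succ', hr]
        simp
      obtain ⟨h1, h2⟩ := ih h hk
      rw [tailProd_cons_succ, hD, List.sublistsLen_succ_cons]
      set D := ∑ i ∈ Finset.range k, (G.rank (G.head e) - i) with hDdef
      set f := fun l : List G.E => (l.map fun e => G.theta F (FreeAlgebra.ι F e)).prod with hf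
      have hS : ((π.sublistsLen k).map f).sum ∈ G.degSpan F (· ≤ D) := by
        rw [← sub_add_cancel (List.sum _) (G.tailProd F π k)]
        exact Submodule.add_mem _ (degSpan_mono (fun n hn => le_of_lt hn) h2)
          (degSpan_mono (fun n hn => le_of_eq hn) h1)
      have hS' : ((π.sublistsLen (k + 1)).map f).sum ∈
          G.degSpan F (· < D + G.rank (G.tail e)) := by
        rcases hk.eq_or_lt with rfl | hlt
        · rw [List.sublistsLen_of_length_lt (Nat.lt_succ_self _)]
          exact Submodule.zero_mem _
        · obtain ⟨h3, h4⟩ := ih h (k := k + 1) hlt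
          rw [Finset.sum_range_succ, ← hDdef] at h3 h4
          rw [← sub_add_cancel (List.sum _) (G.tailProd F π (k + 1))]
          refine Submodule.add_mem _ (degSpan_mono (fun n hn => ?_) h4)
            (degSpan_mono (fun n hn => ?_) h3) <;> omega
      refine ⟨mul_mem_degSpan (fun i j hi hj => by omega) (vert_mem_degSpan _) h1, ?_⟩
      have hsum : (((π.sublistsLen (k + 1)) ++ (π.sublistsLen k).map (List.cons e)).map f).sum -
          G.vert F (G.tail e) * G.tailProd F π k = ((π.sublistsLen (k + 1)).map f).sum +
          G.vert F (G.tail e) * (((π.sublistsLen k).map f).sum - G.tailProd F π k) -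
          G.vert F (G.head e) * ((π.sublistsLen k).map f).sum := by
        have : (((π.sublistsLen k).map (List.cons e)).map f).sum =
            G.theta F (FreeAlgebra.ι F e) * ((π.sublistsLen k).map f).sum := by
          rw [List.map_map, ← List.sum_map_mul_left]
          simp [hf, Function.comp_def]
        rw [List.map_append, List.sum_append, this, theta_ι]
        noncomm_ring
      rw [hsum]
      refine Submodule.sub_mem _ (Submodule.add_mem _ hS' ?_) ?_
      · exact mul_mem_degSpan (fun i j hi hj => by omega) (vert_mem_degSpan _) h2
      · exact mul_mem_degSpan (fun i j hi hj => by omega) (vert_mem_degSpan _) hS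

theorem mul_mem_grIdeal_of_homogeneous (hfull : G.EdgeFull) {r : FreeAlgebra F G.E}
    {x a b : FreeAlgebra F G.Vp} {D m n : ℕ} (hr : r ∈ G.Rideal F) (hx : x ∈ G.degSpan F (· = D))
    (hrx : G.theta F r - x ∈ G.degSpan F (· < D)) (ha : a ∈ G.degSpan F (· = m))
    (hb : b ∈ G.degSpan F (· = n)) :
    a * x * b ∈ G.grIdeal F (Submodule.map (G.theta F).toLinearMap (G.Rideal F)) := by
  refine Submodule.mem_iSup_of_mem (m + D + n) (Submodule.mem_inf.mpr ⟨?_, ?_⟩)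
  · rw [homogV_eq_degSpan]
    exact mul_mem_degSpan (p := (· = m + D)) (q := (· = n)) (fun i j hi hj => by omega)
      (mul_mem_degSpan (p := (· = m)) (q := (· = D)) (fun i j hi hj => by omega) ha hx) hb
  · rw [degSpan_lt]
    have h₁ : a * (G.theta F r - x) * b ∈ G.degSpan F (· < m + D + n) :=
      mul_mem_degSpan (p := (· < m + D)) (q := (· = n)) (fun i j hi hj => by omega)
        (mul_mem_degSpan (p := (· = m)) (q := (· < D)) (fun i j hi hj => by omega) ha hrx) hb
    have h₂ : a * G.theta F r * b ∈ Submodule.map (G.theta F).toLinearMap (G.Rideal F) := by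
      obtain ⟨a, rfl⟩ := theta_surjective hfull a
      obtain ⟨b, rfl⟩ := theta_surjective hfull b
      rw [← map_mul, ← map_mul]
      exact Submodule.mem_map_of_mem (f := (G.theta F).toLinearMap) (mul_mem_twoSidedSpan hr a b)
    have : a * x * b = -(a * (G.theta F r - x) * b) + a * G.theta F r * b := by
      rw [mul_sub, sub_mul]
      abel
    rw [this]
    exact Submodule.add_mem_sup (Submodule.neg_mem _ h₁) h₂

theorem mul_mem_grIdeal (hfull : G.EdgeFull) {r : FreeAlgebra F G.E}
    {x : FreeAlgebra F G.Vp} {D : ℕ} (hr : r ∈ G.Rideal F) (hx : x ∈ G.degSpan F (· = D))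
    (hrx : G.theta F r - x ∈ G.degSpan F (· < D)) (a b : FreeAlgebra F G.Vp) :
    a * x * b ∈ G.grIdeal F (Submodule.map (G.theta F).toLinearMap (G.Rideal F)) := by
  have ha : a ∈ G.degSpan F fun _ => True := degSpan_true (G := G) (F := F) ▸ trivial
  have hb : b ∈ G.degSpan F fun _ => True := degSpan_true (G := G) (F := F) ▸ trivial
  induction ha, hb using Submodule.span_induction₂ with
  | mem_mem a b ha hb =>
    obtain ⟨l, -, rfl⟩ := ha
    obtain ⟨l', -, rfl⟩ := hb
    exact mul_mem_grIdeal_of_homogeneous hfull hr hx hrx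
      (Submodule.subset_span ⟨l, rfl, rfl⟩) (Submodule.subset_span ⟨l', rfl, rfl⟩)
  | zero_left =>
    rw [zero_mul, zero_mul]
    exact Submodule.zero_mem _
  | zero_right =>
    rw [mul_zero]
    exact Submodule.zero_mem _
  | add_left a a' b _ _ _ h h' =>
    rw [add_mul, add_mul]
    exact Submodule.add_mem _ h h'
  | add_right a b b' _ _ _ h h' =>
    rw [mul_add]
    exact Submodule.add_mem _ h h'
  | smul_left c a b _ _ h =>
    rw [smul_mul_assoc, smul_mul_assoc]
    exact Submodule.smul_mem _ _ h
  | smul_right c a b _ _ h =>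
    rw [mul_smul_comm]
    exact Submodule.smul_mem _ _ h

theorem Rgr_le_grIdeal (hmin : G.HasUniqueMin) (hfull : G.EdgeFull) :
    G.Rgr F ≤ G.grIdeal F (Submodule.map (G.theta F).toLinearMap (G.Rideal F)) := by
  obtain ⟨s, -, hs⟩ := hmin
  refine Submodule.span_le.mpr ?_
  rintro _ ⟨a, _, b, ⟨π₁, π₂, k, h₁, h₂, hf, hk, hk₁, hk₂, rfl⟩, rfl⟩
  obtain ⟨v, u₁, hw₁, hv₁, -⟩ := exists_isWalk_of_isPathList h₁
  obtain ⟨v', u₂, hw₂, hv₂, -⟩ := exists_isWalk_of_isPathList h₂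
  obtain rfl : v = v' := by rw [hv₁, hv₂] at hf; exact Option.some.inj hf
  rw [vmon_eq_tailProd hw₁ hk₁, vmon_eq_tailProd hw₂ hk₂]
  obtain ⟨σ₁, t₁, hσ₁, ht₁⟩ := exists_isWalk_rank_zero hfull u₁
  obtain ⟨σ₂, t₂, hσ₂, ht₂⟩ := exists_isWalk_rank_zero hfull u₂
  obtain rfl := hs _ ht₁
  obtain rfl := hs _ ht₂
  have hτ₁ := hw₁.append hσ₁
  have hτ₂ := hw₂.append hσ₂
  have hkτ₁ : k ≤ (π₁ ++ σ₁).length := by rw [List.length_append]; omega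
  have hkτ₂ : k ≤ (π₂ ++ σ₂).length := by rw [List.length_append]; omega
  rw [← tailProd_append hk₁ σ₁, ← tailProd_append hk₂ σ₂]
  generalize π₁ ++ σ₁ = τ₁ at hτ₁ hkτ₁
  generalize π₂ ++ σ₂ = τ₂ at hτ₂ hkτ₂
  have hr : G.ecoef F τ₁ k - G.ecoef F τ₂ k ∈ G.Rideal F := by
    rcases τ₁ with _ | ⟨e₁, τ₁⟩
    · simp only [List.length_nil] at hkτ₁; omega
    rcases τ₂ with _ | ⟨e₂, τ₂⟩
    · simp only [List.length_nil] at hkτ₂; omega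
    obtain ⟨hp₁, hf₁, hl₁⟩ := isWalk_cons_iff.mp hτ₁
    obtain ⟨hp₂, hf₂, hl₂⟩ := isWalk_cons_iff.mp hτ₂
    exact mem_twoSidedSpan_of_mem ⟨_, _, k, hp₁, hp₂, hf₁.trans hf₂.symm, hl₁.trans hl₂.symm,
      by omega, hkτ₁, rfl⟩
  obtain ⟨hd₁, hlow₁⟩ := tailProd_leading (F := F) hτ₁ hkτ₁
  obtain ⟨hd₂, hlow₂⟩ := tailProd_leading (F := F) hτ₂ hkτ₂
  set D := ∑ i ∈ Finset.range k, (G.rank v - i)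
  have hd := Submodule.sub_mem _ hd₁ hd₂
  have hlow := Submodule.sub_mem _ hlow₁ hlow₂
  have hθ : G.theta F (((-1 : F) ^ k) • (G.ecoef F τ₁ k - G.ecoef F τ₂ k)) =
      ((τ₁.sublistsLen k).map fun l =>
        (l.map fun e => G.theta F (FreeAlgebra.ι F e)).prod).sum -
      ((τ₂.sublistsLen k).map fun l =>
        (l.map fun e => G.theta F (FreeAlgebra.ι F e)).prod).sum := by
    rw [map_smul, map_sub, map_ecoef, map_ecoef, ← smul_sub, smul_smul, ← mul_pow]
    simp
  rw [sub_sub_sub_comm, ← hθ] at hlow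
  replace hr := Submodule.smul_mem _ ((-1 : F) ^ k) hr
  generalize ((-1 : F) ^ k) • (G.ecoef F τ₁ k - G.ecoef F τ₂ k) = r at hr hlow
  generalize G.tailProd F τ₁ k - G.tailProd F τ₂ k = x at hd hlow
  exact mul_mem_grIdeal hfull hr hd hlow a b

end LayeredGraph
end

/-- Proposition 2.5: `gr A(Γ) ≅ T(V⁺)/R_gr`.  Since
`gr A(Γ) ≅ T(V⁺)/gr θ(R)` canonically, this says that the associated graded
ideal of `θ(R)` equals the ideal `R_gr` generated by the differences
`v(π₁,k) - v(π₂,k)` over paths with common tail and `2 ≤ k ≤ l(πᵢ)`. -/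
theorem grIdeal_theta_R_eq_Rgr (G : LayeredGraph) (F : Type) [Field F]
    (hmin : G.HasUniqueMin) (hfull : G.EdgeFull) :
    G.grIdeal F (Submodule.map (G.theta F).toLinearMap (G.Rideal F)) = G.Rgr F := by
  exact le_antisymm (LayeredGraph.grIdeal_le_Rgr hfull) (LayeredGraph.Rgr_le_grIdeal hmin hfull)
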